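/- There exists a graph G on 11 vertices that is maxnil but is not maximal without a K_6 minor; that is, G has no minor in the Petersen family, G + ab has a Petersen-family minor for every pair of nonadjacent vertices a, b of G, and yet there exist nonadjacent vertices v, w of G such that G + vw has no K_6 minor. -/

import Mathlib

open SimpleGraph

/-- `H` is a minor of `G`: there is a family of nonempty, pairwise disjoint,
connected branch sets in `G`, one for each vertex of `H`, with an edge of `G`
between the branch sets of any two adjacent vertices of `H`. -/
def IsMinor {W V : Type} (H : SimpleGraph W) (G : SimpleGraph V) : Prop :=
  ∃ f : W → Set V,
    (∀ w, (f w).Nonempty) ∧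
    (∀ w, (G.induce (f w)).Connected) ∧
    (Pairwise fun w₁ w₂ => Disjoint (f w₁) (f w₂)) ∧
    ∀ ⦃w₁ w₂⦄, H.Adj w₁ w₂ → ∃ v₁ ∈ f w₁, ∃ v₂ ∈ f w₂, G.Adj v₁ v₂

/-- The result of a `∇Y`-move on the triangle `a b c` of `G`: delete the edges of
the triangle and add a new vertex (`none`) joined to `a`, `b`, `c`. -/
def triangleY {V : Type} (G : SimpleGraph V) (a b c : V) : SimpleGraph (Option V) :=
  (SimpleGraph.map Function.Embedding.some
      (G.deleteEdges {s(a, b), s(b, c), s(a, c)})) ⊔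
    SimpleGraph.fromEdgeSet {s((none : Option V), some a), s(none, some b), s(none, some c)}

/-- Membership in the Petersen family: the graphs obtained from `K₆` by
`∇Y`-moves and `Y∇`-moves (the inverse operation), up to isomorphism. -/
inductive IsPetersenFamily : ∀ {V : Type}, SimpleGraph V → Prop
  | k6 : IsPetersenFamily (⊤ : SimpleGraph (Fin 6))
  | deltaY {V : Type} {G : SimpleGraph V} {a b c : V} :
      IsPetersenFamily G → G.Adj a b → G.Adj b c → G.Adj a c →
      IsPetersenFamily (triangleY G a b c)
  | yDelta {V : Type} {G : SimpleGraph V} {a b c : V} :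
      IsPetersenFamily (triangleY G a b c) → G.Adj a b → G.Adj b c → G.Adj a c →
      IsPetersenFamily G
  | iso {V W : Type} {G : SimpleGraph V} {H : SimpleGraph W} :
      IsPetersenFamily G → G ≃g H → IsPetersenFamily H

/-- A graph is linklessly embeddable (nIL) iff it has no minor in the Petersen family. -/
def IsLinkless {V : Type} (G : SimpleGraph V) : Prop :=
  ∀ ⦃W : Type⦄ (P : SimpleGraph W), IsPetersenFamily P → ¬ IsMinor P G

/-- The graph obtained from `G` by adding the edge `ab`. -/
def addEdge {V : Type} (G : SimpleGraph V) (a b : V) : SimpleGraph V :=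
  G ⊔ SimpleGraph.fromEdgeSet {s(a, b)}

/-- A nIL graph is maxnil if adding any edge yields a graph that is not nIL. -/
def IsMaxnil {V : Type} (G : SimpleGraph V) : Prop :=
  IsLinkless G ∧ ∀ a b : V, a ≠ b → ¬ G.Adj a b → ¬ IsLinkless (addEdge G a b)

/-- `S` is a vertex cut set of the connected graph `G` if `G - S` is disconnected. -/
def IsVertexCut {V : Type} (G : SimpleGraph V) (S : Set V) : Prop :=
  G.Connected ∧ ¬ (G.induce Sᶜ).Preconnected

/-- A vertex cut set is minimal if no proper subset of it is a vertex cut set. -/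
def IsMinimalVertexCut {V : Type} (G : SimpleGraph V) (S : Set V) : Prop :=
  IsVertexCut G S ∧ ∀ S' ⊂ S, ¬ IsVertexCut G S'

/-- A set `T` of vertices of `H` (inducing a `K₄`) is strongly separating if `H - T`
has at least two connected components such that every vertex of `T` has a
neighbor in each of them. -/
def StronglySeparating {V : Type} (H : SimpleGraph V) (T : Set V) : Prop :=
  ∃ C₁ C₂ : (H.induce Tᶜ).ConnectedComponent, C₁ ≠ C₂ ∧
    ∀ v ∈ T, (∃ u ∈ C₁.supp, H.Adj v ↑u) ∧ (∃ u ∈ C₂.supp, H.Adj v ↑u)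

/-- `G` is maximal without a `K₆` minor. -/
def IsMaximalK6MinorFree {V : Type} (G : SimpleGraph V) : Prop :=
  ¬ IsMinor (⊤ : SimpleGraph (Fin 6)) G ∧
    ∀ a b : V, a ≠ b → ¬ G.Adj a b → IsMinor (⊤ : SimpleGraph (Fin 6)) (addEdge G a b)

/-! ### Connectivity and models -/

/-- Connectivity of a vertex set, in terms of cuts. -/
def CutConn {V : Type} (G : SimpleGraph V) (s : Set V) : Prop :=
  s.Nonempty ∧ ∀ c ⊆ s, c.Nonempty → (∀ x ∈ c, ∀ y ∈ s, G.Adj x y → y ∈ c) → c = s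

theorem cutConn_iff {V : Type} (G : SimpleGraph V) (s : Set V) :
    (G.induce s).Connected ↔ CutConn G s := by
  constructor
  · intro h
    refine ⟨Set.nonempty_coe_sort.mp h.nonempty, ?_⟩
    intro c hcs ⟨x, hx⟩ hcl
    apply Set.Subset.antisymm hcs
    intro y hy
    have key : ∀ (a b : s), (G.induce s).Walk a b → (a : V) ∈ c → (b : V) ∈ c := by
      intro a b p
      induction p with
      | nil => exact id
      | cons hadj _ ih =>
        intro ha
        exact ih (hcl _ ha _ (Subtype.property _) hadj)
    obtain ⟨p⟩ := h.preconnected ⟨x, hcs hx⟩ ⟨y, hy⟩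
    exact key _ _ p hx
  · rintro ⟨⟨x, hx⟩, h⟩
    haveI : Nonempty s := ⟨⟨x, hx⟩⟩
    refine ⟨?_⟩
    have key : ∀ a b : s, (G.induce s).Reachable a b := by
      intro a b
      have hc := h {y | ∃ hy : y ∈ s, (G.induce s).Reachable a ⟨y, hy⟩}
        (fun y hy => hy.1) ⟨a, a.2, Reachable.refl _⟩ (by
          rintro y ⟨hy, hr⟩ z hz hyz
          refine ⟨hz, hr.trans ?_⟩
          exact Adj.reachable (G := G.induce s) (u := ⟨y, hy⟩) (v := ⟨z, hz⟩) hyz)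
      have hb : (b : V) ∈ {y | ∃ hy : y ∈ s, (G.induce s).Reachable a ⟨y, hy⟩} := by
        rw [hc]; exact b.2
      exact hb.2
    exact key

/-- A model of `H` in `G` given by branch sets. -/
structure IsModel {W V : Type} (H : SimpleGraph W) (G : SimpleGraph V) (f : W → Set V) :
    Prop where
  conn : ∀ w, CutConn G (f w)
  disj : ∀ a b, a ≠ b → ∀ x, x ∈ f a → x ∉ f b
  edge : ∀ a b, H.Adj a b → ∃ x ∈ f a, ∃ y ∈ f b, G.Adj x y

theorem isMinor_iff {W V : Type} (H : SimpleGraph W) (G : SimpleGraph V) :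
    IsMinor H G ↔ ∃ f, IsModel H G f := by
  constructor
  · rintro ⟨f, -, h2, h3, h4⟩
    refine ⟨f, fun w => (cutConn_iff _ _).1 (h2 w), ?_, fun a b h => h4 h⟩
    intro a b hab x hx hy
    exact Set.disjoint_left.1 (h3 hab) hx hy
  · rintro ⟨f, h1, h2, h3⟩
    refine ⟨f, fun w => (h1 w).1, fun w => (cutConn_iff _ _).2 (h1 w), ?_, fun a b h => h3 a b h⟩
    intro a b hab
    exact Set.disjoint_left.2 (fun x => h2 a b hab x)

theorem IsModel.iso {W W' V : Type} {H : SimpleGraph W} {H' : SimpleGraph W'}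
    {G : SimpleGraph V} {f : W → Set V} (h : IsModel H G f) (e : H ≃g H') :
    IsModel H' G (fun w => f (e.symm w)) where
  conn w := h.conn _
  disj a b hab := h.disj _ _ (fun hh => hab (e.symm.injective hh))
  edge a b hab := h.edge _ _ (e.symm.map_rel_iff.2 hab)

theorem IsModel.trans {A B V : Type} {H : SimpleGraph A} {K : SimpleGraph B}
    {G : SimpleGraph V} {h : A → Set B} {f : B → Set V}
    (hh : IsModel H K h) (hf : IsModel K G f) :
    IsModel H G (fun a => {v | ∃ s ∈ h a, v ∈ f s}) where
  conn a := by
    refine ⟨?_, ?_⟩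
    · obtain ⟨s, hs⟩ := (hh.conn a).1
      obtain ⟨v, hv⟩ := (hf.conn s).1
      exact ⟨v, s, hs, hv⟩
    · intro c hcs hne hcl
      apply Set.Subset.antisymm hcs
      -- each branch set is contained in `c` or disjoint from it
      have full : ∀ s ∈ h a, (∃ v ∈ f s, v ∈ c) → f s ⊆ c := by
        intro s hs ⟨v, hv, hvc⟩
        have := (hf.conn s).2 (f s ∩ c) Set.inter_subset_left ⟨v, hv, hvc⟩ (by
          rintro x ⟨hx, hxc⟩ y hy hxy
          exact ⟨hy, hcl x hxc y ⟨s, hs, hy⟩ hxy⟩)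
        rw [← this]
        exact Set.inter_subset_right
      have hall := (hh.conn a).2 {s | s ∈ h a ∧ f s ⊆ c} (fun s hs => hs.1) (by
          obtain ⟨v, hv⟩ := hne
          obtain ⟨s, hs, hvs⟩ := hcs hv
          exact ⟨s, hs, full s hs ⟨v, hvs, hv⟩⟩) (by
          rintro s ⟨hs, hsc⟩ t ht hst
          obtain ⟨x, hx, y, hy, hxy⟩ := hf.edge s t hst
          exact ⟨ht, full t ht ⟨y, hy, hcl x (hsc hx) y ⟨t, ht, hy⟩ hxy⟩⟩)
      rintro v ⟨s, hs, hv⟩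
      rw [← hall] at hs
      exact hs.2 hv
  disj a b hab x := by
    rintro ⟨s, hs, hx⟩ ⟨t, ht, hx'⟩
    by_cases hst : s = t
    · subst hst
      exact hh.disj a b hab s hs ht
    · exact hf.disj s t hst x hx hx'
  edge a b hab := by
    obtain ⟨s, hs, t, ht, hst⟩ := hh.edge a b hab
    obtain ⟨x, hx, y, hy, hxy⟩ := hf.edge s t hst
    exact ⟨x, ⟨s, hs, hx⟩, y, ⟨t, ht, hy⟩, hxy⟩

/-- A vertex whose neighbourhood is a clique can be removed from a model, unless it is
a whole branch set. -/
theorem IsModel.avoid {W V : Type} {H : SimpleGraph W} {G : SimpleGraph V} {f : W → Set V}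
    (h : IsModel H G f) (u : V)
    (hcl : ∀ p q, G.Adj u p → G.Adj u q → p ≠ q → G.Adj p q) :
    (∃ w, f w = {u}) ∨ ∃ f', IsModel H G f' ∧ ∀ w, u ∉ f' w := by
  by_cases hw : ∃ w, f w = {u}
  · exact Or.inl hw
  right
  push Not at hw
  -- a neighbour of `u` in its branch set
  have nbr : ∀ w, u ∈ f w → ∃ p ∈ f w, p ≠ u ∧ G.Adj u p := by
    intro w hu
    by_contra hcon
    push Not at hcon
    apply hw w
    symm
    apply (h.conn w).2 {u} (by simpa using hu) ⟨u, rfl⟩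
    rintro x hx y hy hxy
    rw [Set.mem_singleton_iff] at hx
    subst hx
    exact absurd hxy (hcon y hy hxy.ne')
  refine ⟨fun w => f w \ {u}, ⟨?_, ?_, ?_⟩, fun w hh => hh.2 rfl⟩
  · intro w
    by_cases hu : u ∈ f w
    · obtain ⟨p, hp, hpu, hup⟩ := nbr w hu
      refine ⟨⟨p, hp, hpu⟩, ?_⟩
      intro c hcs hne hc
      by_cases hq : ∃ q ∈ c, G.Adj u q
      · obtain ⟨q, hqc, huq⟩ := hq
        have := (h.conn w).2 (insert u c)
          (Set.insert_subset hu (hcs.trans Set.diff_subset)) ⟨u, Set.mem_insert _ _⟩ (by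
            intro x hx y hy hxy
            by_cases hyu : y = u
            · exact hyu ▸ Set.mem_insert _ _
            right
            rcases hx with rfl | hx
            · by_cases hqy : q = y
              · exact hqy ▸ hqc
              · exact hc q hqc y ⟨hy, hyu⟩ (hcl q y huq hxy hqy)
            · exact hc x hx y ⟨hy, hyu⟩ hxy)
        apply Set.Subset.antisymm hcs
        rintro y ⟨hy, hyu⟩
        rw [← this] at hy
        exact hy.resolve_left hyu
      · exfalso
        have := (h.conn w).2 c (hcs.trans Set.diff_subset) hne (by
          intro x hx y hy hxy
          by_cases hyu : y = u
          · subst hyu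
            exact absurd ⟨x, hx, hxy.symm⟩ hq
          · exact hc x hx y ⟨hy, hyu⟩ hxy)
        rw [← this] at hu
        exact (hcs hu).2 rfl
    · have : f w \ {u} = f w := by
        ext x
        simp only [Set.mem_diff, Set.mem_singleton_iff, and_iff_left_iff_imp]
        rintro hx rfl
        exact hu hx
      simpa only [this] using h.conn w
  · intro a b hab x hx hy
    exact h.disj a b hab x hx.1 hy.1
  · intro a b hab
    obtain ⟨x, hx, y, hy, hxy⟩ := h.edge a b hab
    by_cases hxu : x = u
    · subst hxu
      obtain ⟨p, hp, hpu, hup⟩ := nbr a hx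
      have hyu : y ≠ x := hxy.ne'
      refine ⟨p, ⟨hp, hpu⟩, y, ⟨hy, hyu⟩, hcl p y hup hxy ?_⟩
      rintro rfl
      exact h.disj a b hab.ne p hp hy
    · by_cases hyu : y = u
      · subst hyu
        obtain ⟨p, hp, hpu, hup⟩ := nbr b hy
        refine ⟨x, ⟨hx, hxu⟩, p, ⟨hp, hpu⟩, hcl x p hxy.symm hup ?_⟩
        rintro rfl
        exact h.disj a b hab.ne x hx hp
      · exact ⟨x, ⟨hx, hxu⟩, y, ⟨hy, hyu⟩, hxy⟩

/-- If `{u}` is a branch set, the degree is bounded by the number of neighbours of `u`. -/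
theorem IsModel.degree {W V : Type} [Fintype W] {H : SimpleGraph W} [DecidableRel H.Adj]
    {G : SimpleGraph V} {f : W → Set V}
    (h : IsModel H G f) {w : W} {u : V} (hw : f w = {u}) (N : Finset V)
    (hN : ∀ v, G.Adj u v → v ∈ N) :
    (Finset.univ.filter (fun t => H.Adj w t)).card ≤ N.card := by
  have hex : ∀ t, H.Adj w t → ∃ y ∈ f t, G.Adj u y := by
    intro t ht
    obtain ⟨x, hx, y, hy, hxy⟩ := h.edge w t ht
    rw [hw, Set.mem_singleton_iff] at hx
    subst hx
    exact ⟨y, hy, hxy⟩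
  classical
  apply Finset.card_le_card_of_injOn
    (fun t => if ht : H.Adj w t then (hex t ht).choose else u)
  · intro t ht
    simp only [Finset.coe_filter, Finset.mem_univ, true_and, Set.mem_setOf_eq] at ht
    simp only [ht, dif_pos]
    exact hN _ (hex t ht).choose_spec.2
  · intro t ht s hs hts
    simp only [Finset.coe_filter, Finset.mem_univ, true_and, Set.mem_setOf_eq] at ht hs
    simp only [ht, hs, dif_pos] at hts
    by_contra hne
    refine h.disj t s hne _ (hex t ht).choose_spec.1 ?_
    rw [hts]
    exact (hex s hs).choose_spec.1

/-- Each element of the list but the last is related to a later one. -/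
def listConn (r : ℕ → ℕ → Bool) : List ℕ → Bool
  | [] => false
  | [_] => true
  | a :: b :: l => (b :: l).any (r a) && listConn r (b :: l)

theorem listConn_spec {n : ℕ} (G : SimpleGraph (Fin n)) (r : ℕ → ℕ → Bool)
    (hr : ∀ x y : Fin n, r x y = true → G.Adj x y) :
    ∀ l : List ℕ, (∀ x ∈ l, x < n) → listConn r l = true →
      CutConn G {v : Fin n | (v : ℕ) ∈ l}
  | [], _, h => by simp [listConn] at h
  | [a], hl, _ => by
    have ha : a < n := hl a (by simp)
    refine ⟨⟨⟨a, ha⟩, by simp⟩, ?_⟩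
    intro c hcs ⟨x, hx⟩ _
    apply Set.Subset.antisymm hcs
    intro y hy
    have hxa := hcs hx
    simp only [List.mem_singleton, Set.mem_setOf_eq] at hxa hy
    have : y = x := Fin.ext (hy.trans hxa.symm)
    exact this ▸ hx
  | a :: b :: l, hl, h => by
    have ha : a < n := hl a (by simp)
    simp only [listConn, Bool.and_eq_true, List.any_eq_true] at h
    obtain ⟨⟨b', hb', hab⟩, h2⟩ := h
    have ih := listConn_spec G r hr (b :: l) (fun x hx => hl x (List.mem_cons_of_mem _ hx)) h2
    have hbn : b' < n := hl b' (List.mem_cons_of_mem _ hb')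
    have hadj : G.Adj ⟨a, ha⟩ ⟨b', hbn⟩ := hr ⟨a, ha⟩ ⟨b', hbn⟩ hab
    refine ⟨⟨⟨a, ha⟩, by simp⟩, ?_⟩
    intro c hcs hne hcl
    apply Set.Subset.antisymm hcs
    -- some element of `c` lies in the tail
    have hin : ∃ x ∈ c, (x : ℕ) ∈ b :: l := by
      obtain ⟨x, hx⟩ := hne
      rcases List.mem_cons.1 (hcs hx) with hxa | hxl
      · have hx' : x = ⟨a, ha⟩ := Fin.ext hxa
        refine ⟨⟨b', hbn⟩, hcl x hx _ (List.mem_cons_of_mem _ hb') ?_, hb'⟩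
        rw [hx']; exact hadj
      · exact ⟨x, hx, hxl⟩
    have hc := ih.2 (c ∩ {v : Fin n | (v : ℕ) ∈ b :: l}) Set.inter_subset_right
      (by obtain ⟨x, hx, hxl⟩ := hin; exact ⟨x, hx, hxl⟩) (by
        rintro x ⟨hx, _⟩ y hy hxy
        exact ⟨hcl x hx y (List.mem_cons_of_mem _ hy) hxy, hy⟩)
    have htail : ∀ y : Fin n, (y : ℕ) ∈ b :: l → y ∈ c := by
      intro y hy
      have : y ∈ {v : Fin n | (v : ℕ) ∈ b :: l} := hy
      rw [← hc] at this
      exact this.1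
    intro y hy
    rcases List.mem_cons.1 hy with hya | hyl
    · have hy' : y = ⟨a, ha⟩ := Fin.ext hya
      rw [hy'] at hy ⊢
      exact hcl ⟨b', hbn⟩ (htail _ hb') _ hy hadj.symm
    · exact htail y hyl

/-- Boolean check that lists of vertices form a model, `rH`, `r` being the relations. -/
def modelCheck (k : ℕ) (rH : ℕ → ℕ → Bool) (n : ℕ) (r : ℕ → ℕ → Bool)
    (h : List (List ℕ)) : Bool :=
  (List.range k).all fun a =>
    (h.getD a []).all (fun x => decide (x < n)) && listConn r (h.getD a []) &&
    (List.range k).all fun b =>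
      (decide (a = b) || (h.getD a []).all fun x => !(h.getD b []).contains x) &&
      (!rH a b || (h.getD a []).any fun x => (h.getD b []).any fun y => r x y)

theorem modelCheck_spec {k n : ℕ} {H : SimpleGraph (Fin k)} {G : SimpleGraph (Fin n)}
    {rH r : ℕ → ℕ → Bool} {h : List (List ℕ)}
    (hr : ∀ x y : Fin n, r x y = true → G.Adj x y)
    (hH : ∀ x y : Fin k, H.Adj x y → rH x y = true)
    (hc : modelCheck k rH n r h = true) :
    IsModel H G (fun a => {v : Fin n | (v : ℕ) ∈ h.getD a []}) := by
  simp only [modelCheck, List.all_eq_true, List.mem_range, Bool.and_eq_true, Bool.or_eq_true,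
    decide_eq_true_eq, Bool.not_eq_true', List.any_eq_true, List.contains_eq_mem,
    decide_eq_false_iff_not] at hc
  refine ⟨?_, ?_, ?_⟩
  · intro a
    obtain ⟨⟨h1, h2⟩, _⟩ := hc a a.2
    exact listConn_spec G r hr _ h1 h2
  · intro a b hab x hx
    obtain ⟨_, h3⟩ := hc a a.2
    obtain ⟨h4, _⟩ := h3 b b.2
    rcases h4 with h4 | h4
    · exact absurd (Fin.ext h4) hab
    · exact h4 x hx
  · intro a b hab
    obtain ⟨⟨h1, _⟩, h3⟩ := hc a a.2
    obtain ⟨⟨h1', _⟩, _⟩ := hc b b.2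
    obtain ⟨_, h5⟩ := h3 b b.2
    rcases h5 with h5 | ⟨x, hx, y, hy, hxy⟩
    · rw [hH a b hab] at h5
      exact absurd h5 (by simp)
    · exact ⟨⟨x, h1 x hx⟩, hx, ⟨y, h1' y hy⟩, hy, hr ⟨x, h1 x hx⟩ ⟨y, h1' y hy⟩ hxy⟩

/-! ### Data -/

/-- Adjacency rows (as bit masks) of the seven graphs of the Petersen family. -/
def famRows : ℕ → List ℕ
  | 0 => [62, 61, 59, 55, 47, 31]
  | 1 => [120, 120, 120, 55, 47, 31, 7]
  | 2 => [60, 60, 83, 83, 111, 83, 60]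
  | 3 => [224, 120, 120, 166, 166, 31, 7, 25]
  | 4 => [120, 120, 120, 135, 135, 135, 7, 56]
  | 5 => [224, 336, 120, 388, 166, 277, 7, 25, 42]
  | _ => [224, 336, 584, 388, 642, 769, 7, 25, 42, 52]

/-- Number of vertices of the seven graphs. -/
def famN : ℕ → ℕ
  | 0 => 6
  | 1 => 7
  | 2 => 7
  | 3 => 8
  | 4 => 8
  | 5 => 9
  | _ => 10

/-- `σ ∈ famTab i j` encodes an isomorphism of a `∇Y` of graph `i` onto graph `j`:
the head is the image of the new vertex, the tail lists the images of the old ones. -/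
def famTab : ℕ → ℕ → List (List ℕ)
  | 0, 1 => [
    [6, 0, 1, 2, 3, 4, 5],
    [6, 0, 1, 3, 2, 4, 5],
    [6, 0, 1, 3, 4, 2, 5],
    [6, 0, 1, 3, 4, 5, 2],
    [6, 0, 3, 1, 2, 4, 5],
    [6, 0, 3, 1, 4, 2, 5],
    [6, 0, 3, 1, 4, 5, 2],
    [6, 0, 3, 4, 1, 2, 5],
    [6, 0, 3, 4, 1, 5, 2],
    [6, 0, 3, 4, 5, 1, 2],
    [6, 3, 0, 1, 2, 4, 5],
    [6, 3, 0, 1, 4, 2, 5],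
    [6, 3, 0, 1, 4, 5, 2],
    [6, 3, 0, 4, 1, 2, 5],
    [6, 3, 0, 4, 1, 5, 2],
    [6, 3, 0, 4, 5, 1, 2],
    [6, 3, 4, 0, 1, 2, 5],
    [6, 3, 4, 0, 1, 5, 2],
    [6, 3, 4, 0, 5, 1, 2],
    [6, 3, 4, 5, 0, 1, 2]]
  | 1, 3 => [
    [7, 0, 1, 2, 3, 4, 5, 6],
    [7, 0, 1, 2, 3, 5, 4, 6],
    [7, 0, 1, 2, 5, 3, 4, 6],
    [7, 1, 0, 2, 3, 4, 5, 6],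
    [7, 1, 0, 2, 3, 5, 4, 6],
    [7, 1, 0, 2, 5, 3, 4, 6],
    [7, 1, 2, 0, 3, 4, 5, 6],
    [7, 1, 2, 0, 3, 5, 4, 6],
    [7, 1, 2, 0, 5, 3, 4, 6],
    [6, 0, 3, 4, 1, 2, 5, 7]]
  | 1, 4 => [
    [7, 0, 1, 2, 3, 4, 5, 6],
    [6, 3, 4, 5, 0, 1, 2, 7]]
  | 2, 3 => [
    [0, 6, 3, 7, 1, 5, 2, 4],
    [0, 6, 3, 1, 7, 5, 2, 4],
    [0, 6, 3, 1, 2, 5, 7, 4],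
    [0, 1, 7, 6, 3, 5, 4, 2],
    [0, 1, 7, 3, 6, 5, 4, 2],
    [0, 1, 7, 3, 4, 5, 6, 2],
    [0, 1, 2, 6, 3, 5, 4, 7],
    [0, 1, 2, 3, 6, 5, 4, 7],
    [0, 1, 2, 3, 4, 5, 6, 7]]
  | 3, 5 => [
    [8, 0, 1, 2, 3, 4, 5, 6, 7],
    [8, 0, 1, 2, 4, 3, 5, 6, 7],
    [8, 0, 2, 1, 3, 4, 5, 6, 7],
    [8, 0, 2, 1, 4, 3, 5, 6, 7],
    [0, 8, 2, 7, 4, 6, 5, 3, 1],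
    [1, 7, 2, 8, 5, 6, 4, 3, 0],
    [3, 6, 4, 8, 5, 7, 2, 1, 0],
    [6, 3, 0, 4, 1, 5, 2, 7, 8],
    [7, 1, 0, 2, 3, 5, 4, 6, 8]]
  | 5, 6 => [
    [9, 0, 1, 2, 3, 4, 5, 6, 7, 8],
    [0, 1, 3, 5, 9, 7, 6, 8, 4, 2],
    [1, 0, 3, 4, 9, 8, 6, 7, 5, 2],
    [2, 0, 4, 3, 8, 9, 6, 7, 5, 1],
    [3, 0, 1, 2, 9, 8, 7, 6, 5, 4],
    [4, 0, 2, 1, 8, 9, 7, 6, 5, 3],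
    [5, 1, 2, 0, 7, 9, 8, 6, 4, 3],
    [6, 3, 4, 0, 5, 1, 2, 7, 8, 9],
    [7, 1, 2, 0, 5, 3, 4, 6, 8, 9],
    [8, 0, 2, 1, 4, 3, 5, 6, 7, 9]]
  | _, _ => []

/-- `K₅` models (5 lists) or `K₃₃` models (6 lists) in graph `i` minus vertex `z`. -/
def kurTab : ℕ → List (List (List ℕ))
  | 0 => [
    [[1], [2], [3], [4], [5]],
    [[0], [2], [3], [4], [5]],
    [[0], [1], [3], [4], [5]],
    [[0], [1], [2], [4], [5]],
    [[0], [1], [2], [3], [5]],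
    [[0], [1], [2], [3], [4]]]
  | 1 => [
    [[1], [3], [4], [5], [6, 2]],
    [[0], [3], [4], [5], [6, 2]],
    [[0], [3], [4], [5], [6, 1]],
    [[0], [1], [2], [4], [5], [6]],
    [[0], [1], [2], [3], [5], [6]],
    [[0], [1], [2], [3], [4], [6]],
    [[0], [1], [2], [3], [4], [5]]]
  | 2 => [
    [[1], [4], [6], [2], [3], [5]],
    [[0], [4], [6], [2], [3], [5]],
    [[0], [1], [6], [3], [4], [5]],
    [[0], [1], [6], [2], [4], [5]],
    [[0], [1], [6], [2], [3], [5]],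
    [[0], [1], [6], [2], [3], [4]],
    [[0], [1], [4], [2], [3], [5]]]
  | 3 => [
    [[1], [3], [5], [6, 2], [7, 4]],
    [[0], [3], [4], [5], [7], [6, 2]],
    [[0], [3], [4], [5], [7], [6, 1]],
    [[0], [1], [2], [5], [6], [7, 4]],
    [[0], [1], [2], [5], [6], [7, 3]],
    [[1], [2], [7], [3], [4], [6, 0]],
    [[1], [2], [7], [3], [4], [5, 0]],
    [[1], [2], [5], [3], [4], [6, 0]]]
  | 4 => [
    [[1], [2], [7], [3], [4], [5]],
    [[0], [2], [7], [3], [4], [5]],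
    [[0], [1], [7], [3], [4], [5]],
    [[0], [1], [2], [4], [5], [6]],
    [[0], [1], [2], [3], [5], [6]],
    [[0], [1], [2], [3], [4], [6]],
    [[0], [1], [2], [3], [4], [5]],
    [[0], [1], [2], [3], [4], [5]]]
  | 5 => [
    [[1], [3], [5], [8], [6, 2], [7, 4]],
    [[0], [3], [4], [7], [6, 2], [8, 5]],
    [[0], [4], [8], [5], [6, 1], [7, 3]],
    [[0], [1], [2], [6], [7, 4], [8, 5]],
    [[0], [2], [8], [5], [6, 1], [7, 3]],
    [[1], [2], [7], [4], [6, 0], [8, 3]],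
    [[2], [7], [8], [3], [4, 1], [5, 0]],
    [[1], [2], [5], [4], [6, 0], [8, 3]],
    [[0], [2], [4], [5], [6, 1], [7, 3]]]
  | _ => [
    [[1], [3], [9], [6, 2], [7, 4], [8, 5]],
    [[0], [3], [9], [6, 2], [7, 4], [8, 5]],
    [[0], [4], [8], [6, 1], [7, 3], [9, 5]],
    [[0], [1], [9], [6, 2], [7, 4], [8, 5]],
    [[0], [2], [8], [6, 1], [7, 3], [9, 5]],
    [[1], [2], [7], [6, 0], [8, 3], [9, 4]],
    [[3], [4], [5], [7, 0], [8, 1], [9, 2]],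
    [[1], [2], [5], [6, 0], [8, 3], [9, 4]],
    [[0], [2], [4], [6, 1], [7, 3], [9, 5]],
    [[0], [1], [3], [6, 2], [7, 4], [8, 5]]]

/-- Adjacency rows of the example graph. -/
def exRows : List ℕ := [1774, 893, 1467, 7, 230, 2007, 179, 117, 1574, 1315, 805]

/-- `K₆` models in the example graph plus an edge. -/
def k6Tab : List (ℕ × ℕ × List (List ℕ)) := [
  (0, 4, [[0], [1], [2], [4], [5], [7, 6]]),
  (0, 8, [[0], [1], [2], [5], [8], [10, 9]]),
  (1, 7, [[0], [1], [2], [5], [7], [6, 4]]),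
  (1, 10, [[0], [1], [2], [5], [10], [9, 8]]),
  (2, 6, [[0], [1], [2], [5], [6], [7, 4]]),
  (2, 9, [[0], [1], [2], [5], [9], [10, 8]]),
  (3, 4, [[0], [1], [2], [5], [4, 3], [7, 6]]),
  (3, 6, [[0], [1], [2], [5], [6, 3], [7, 4]]),
  (3, 7, [[0], [1], [2], [5], [6, 4], [7, 3]]),
  (3, 8, [[0], [1], [2], [5], [8, 3], [10, 9]]),
  (3, 9, [[0], [1], [2], [5], [9, 3], [10, 8]]),
  (3, 10, [[0], [1], [2], [5], [9, 8], [10, 3]]),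
  (4, 8, [[0], [1], [2], [5], [6, 4], [9, 8]]),
  (4, 9, [[0], [1], [2], [5], [6, 4], [9, 8]]),
  (4, 10, [[0], [1], [2], [5], [6, 4], [10, 8]]),
  (6, 8, [[0], [1], [2], [5], [6, 4], [9, 8]]),
  (6, 9, [[0], [1], [2], [5], [6, 4], [9, 8]]),
  (6, 10, [[0], [1], [2], [5], [6, 4], [10, 8]]),
  (7, 8, [[0], [1], [2], [5], [6, 4], [8, 7]]),
  (7, 9, [[0], [1], [2], [5], [6, 4], [9, 7]]),
  (7, 10, [[0], [1], [2], [5], [6, 4], [8, 10, 7]])]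

/-- The connected vertex sets of the example graph avoiding the vertices 3 and 5,
as bit masks, each with the bit mask of its neighbourhood. -/
def connTab : List (ℕ × ℕ) := [
  (2007, 2007), (983, 2007), (1495, 2007), (1751, 2007), (1879, 2007), (1943, 2007),
  (1991, 2007), (2003, 2007), (2005, 2007), (2006, 2007), (471, 2007), (727, 2007),
  (855, 2007), (919, 2007), (967, 2007), (979, 2007), (981, 2007), (982, 2007), (1239, 2007),
  (1367, 2007), (1431, 2007), (1479, 2007), (1491, 2007), (1493, 2007), (1494, 2007),
  (1623, 2007), (1687, 2007), (1735, 2007), (1747, 2007), (1749, 2007), (1750, 2007),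
  (1815, 2007), (1863, 2007), (1875, 2007), (1877, 2007), (1878, 2007), (1927, 2007),
  (1939, 2007), (1941, 2007), (1942, 2007), (1987, 2007), (1989, 2007), (1990, 2007),
  (2001, 2007), (2002, 2007), (2004, 2007), (215, 2007), (343, 2007), (407, 2007), (455, 2007),
  (467, 2007), (469, 2007), (470, 2007), (599, 2007), (663, 2007), (711, 2007), (723, 2007),
  (725, 2007), (726, 2007), (791, 2007), (839, 2007), (851, 2007), (853, 2007), (854, 2007),
  (903, 2007), (915, 2007), (917, 2007), (918, 2007), (963, 2007), (965, 2007), (966, 2007),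
  (977, 2007), (978, 2007), (980, 2007), (1111, 2007), (1175, 2007), (1223, 2007),
  (1235, 2007), (1237, 2007), (1238, 2007), (1303, 2007), (1351, 2007), (1363, 2007),
  (1365, 2007), (1366, 2007), (1415, 2007), (1427, 2007), (1429, 2007), (1430, 2007),
  (1475, 2007), (1477, 2007), (1478, 2007), (1489, 2007), (1490, 2007), (1492, 2007),
  (1559, 2007), (1607, 2007), (1619, 2007), (1621, 2007), (1622, 2007), (1671, 2007),
  (1683, 2007), (1685, 2007), (1686, 2007), (1731, 2007), (1733, 2007), (1734, 2007),
  (1745, 2007), (1746, 2007), (1748, 2007), (1799, 2007), (1811, 2007), (1813, 2007),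
  (1814, 2007), (1859, 2007), (1861, 2007), (1862, 2007), (1873, 2007), (1874, 2007),
  (1876, 2007), (1923, 2007), (1925, 2007), (1926, 2007), (1937, 2007), (1938, 2007),
  (1940, 2007), (1985, 2007), (1986, 2007), (1988, 2007), (87, 2007), (151, 2007), (199, 2007),
  (211, 2007), (213, 2007), (214, 2007), (279, 2007), (327, 2007), (339, 2007), (341, 2007),
  (342, 2007), (391, 2007), (403, 2007), (405, 2007), (406, 2007), (451, 2007), (453, 2007),
  (454, 2007), (466, 2007), (468, 2007), (535, 2007), (583, 2007), (595, 2007), (597, 2007),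
  (598, 2007), (647, 2007), (659, 2007), (661, 2007), (662, 2007), (707, 2007), (709, 2007),
  (710, 2007), (721, 2007), (722, 2007), (775, 2007), (787, 2007), (789, 2007), (790, 2007),
  (835, 2007), (837, 2007), (838, 2007), (849, 2007), (850, 2007), (852, 2007), (899, 2007),
  (901, 2007), (902, 2007), (913, 2007), (914, 2007), (916, 2007), (961, 2007), (962, 2007),
  (964, 2007), (1047, 2007), (1095, 2007), (1107, 2007), (1109, 2007), (1110, 2007),
  (1159, 2007), (1171, 2007), (1173, 2007), (1174, 2007), (1219, 2007), (1221, 2007),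
  (1222, 2007), (1233, 2007), (1236, 2007), (1287, 2007), (1299, 2007), (1301, 2007),
  (1302, 2007), (1347, 2007), (1349, 2007), (1350, 2007), (1361, 2007), (1362, 2007),
  (1364, 2007), (1411, 2007), (1413, 2007), (1414, 2007), (1425, 2007), (1426, 2007),
  (1428, 2007), (1473, 2007), (1474, 2007), (1476, 2007), (1543, 2007), (1555, 2007),
  (1557, 2007), (1558, 2007), (1603, 2007), (1605, 2007), (1606, 2007), (1617, 2007),
  (1618, 2007), (1620, 2007), (1667, 2007), (1669, 2007), (1670, 2007), (1681, 2007),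
  (1682, 2007), (1684, 2007), (1729, 2007), (1730, 2007), (1732, 2007), (1795, 2007),
  (1797, 2007), (1798, 2007), (1810, 2007), (1812, 2007), (1857, 2007), (1858, 2007),
  (1921, 2007), (1924, 2007), (23, 2007), (71, 2007), (83, 2007), (85, 2007), (86, 2007),
  (135, 2007), (147, 2007), (149, 2007), (150, 2007), (195, 2007), (197, 2007), (198, 2007),
  (209, 1751), (210, 983), (212, 1495), (263, 2007), (275, 2007), (277, 2007), (278, 2007),
  (323, 2007), (325, 2007), (326, 2007), (338, 2007), (340, 2007), (387, 2007), (389, 2007),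
  (390, 2007), (402, 2007), (404, 2007), (450, 2007), (452, 2007), (519, 2007), (531, 2007),
  (533, 2007), (534, 2007), (579, 2007), (581, 2007), (582, 2007), (593, 2007), (594, 2007),
  (643, 2007), (645, 2007), (646, 2007), (657, 2007), (658, 2007), (705, 2007), (706, 2007),
  (771, 2007), (773, 2007), (774, 2007), (786, 2007), (788, 2007), (833, 2007), (834, 2007),
  (897, 2007), (900, 2007), (1031, 2007), (1043, 2007), (1045, 2007), (1046, 2007),
  (1091, 2007), (1093, 2007), (1094, 2007), (1105, 2007), (1108, 2007), (1155, 2007),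
  (1157, 2007), (1158, 2007), (1169, 2007), (1172, 2007), (1217, 2007), (1220, 2007),
  (1283, 2007), (1285, 2007), (1286, 2007), (1298, 2007), (1300, 2007), (1345, 2007),
  (1346, 2007), (1409, 2007), (1412, 2007), (1539, 2007), (1541, 2007), (1542, 2007),
  (1554, 2007), (1556, 2007), (1601, 2007), (1602, 2007), (1665, 2007), (1668, 2007),
  (1793, 1991), (1794, 1879), (1796, 1943), (7, 2007), (19, 2007), (21, 2007), (22, 2007),
  (67, 2007), (69, 2007), (70, 2007), (81, 1751), (82, 983), (84, 1495), (131, 2007),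
  (133, 2007), (134, 2007), (145, 1751), (146, 983), (148, 1495), (193, 1751), (194, 983),
  (196, 1495), (208, 215), (259, 2007), (261, 2007), (262, 2007), (274, 2007), (276, 2007),
  (322, 2007), (388, 2007), (515, 2007), (517, 2007), (518, 2007), (530, 2007), (577, 2007),
  (578, 2007), (641, 2007), (769, 1991), (770, 1879), (772, 1943), (1027, 2007), (1029, 2007),
  (1030, 2007), (1044, 2007), (1089, 2007), (1153, 2007), (1156, 2007), (1281, 1991),
  (1282, 1879), (1284, 1943), (1537, 1991), (1538, 1879), (1540, 1943), (1792, 1799),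
  (3, 2007), (5, 2007), (6, 2007), (18, 983), (20, 1495), (65, 1751), (66, 983), (80, 215),
  (129, 1751), (132, 1495), (144, 215), (192, 215), (258, 1879), (260, 1943), (513, 1991),
  (514, 1879), (768, 1799), (1025, 1991), (1028, 1943), (1280, 1799), (1536, 1799), (1, 1734),
  (2, 853), (4, 1427), (16, 198), (64, 147), (128, 85), (256, 1542), (512, 1283), (1024, 773)]

/-- The disconnected vertex sets avoiding 3 and 5, each with one component. -/
def sepTab : List (ℕ × ℕ) := [
  (17, 1), (68, 4), (130, 2), (257, 1), (272, 16), (273, 1), (320, 64), (321, 65), (324, 260),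
  (336, 80), (337, 81), (384, 128), (385, 129), (386, 258), (400, 144), (401, 145), (448, 192),
  (449, 193), (464, 208), (465, 209), (516, 4), (528, 16), (529, 513), (532, 20), (576, 64),
  (580, 4), (592, 80), (596, 84), (640, 128), (642, 514), (644, 132), (656, 144), (660, 148),
  (704, 192), (708, 196), (720, 208), (724, 212), (784, 16), (785, 769), (832, 64), (836, 772),
  (848, 80), (896, 128), (898, 770), (912, 144), (960, 192), (976, 208), (1026, 2), (1040, 16),
  (1041, 1025), (1042, 18), (1088, 64), (1090, 66), (1092, 1028), (1104, 80), (1106, 82),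
  (1152, 128), (1154, 2), (1168, 144), (1170, 146), (1216, 192), (1218, 194), (1232, 208),
  (1234, 210), (1296, 16), (1297, 1281), (1344, 64), (1348, 1284), (1360, 80), (1408, 128),
  (1410, 1282), (1424, 144), (1472, 192), (1488, 208), (1552, 16), (1553, 1537), (1600, 64),
  (1604, 1540), (1616, 80), (1664, 128), (1666, 1538), (1680, 144), (1728, 192), (1744, 208),
  (1808, 16), (1809, 1793), (1856, 64), (1860, 1796), (1872, 80), (1920, 128), (1922, 1794),
  (1936, 144), (1984, 192), (2000, 208)]

/-! ### The kernel search -/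

/-- Some element of the list, together with the tail after it, satisfies `p`. -/
def anyTail {α : Type} (p : α → List α → Bool) : List α → Bool
  | [] => false
  | a :: l => match p a l with
    | true => true
    | false => anyTail p l

/-- There are `k` elements in the list pairwise related by `r`. -/
def cliq {α : Type} (r : α → α → Bool) : ℕ → List α → Bool
  | 0, _ => true
  | k + 1, l => anyTail (fun m t => cliq r k (t.filter (r m))) l

/-- The list has at least three elements. -/
def three {α : Type} : List α → Bool
  | _ :: _ :: _ :: _ => true
  | _ => false

/-- `k` elements of the first list pairwise related by `d`, and three elements of the
second list pairwise related by `d`, with all cross pairs related by `r`. -/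
def bicliq {α : Type} (d r : α → α → Bool) : ℕ → List α → List α → Bool
  | 0, _, B => cliq d 3 B
  | k + 1, A, B => anyTail (fun m t => match three (B.filter (r m)) with
      | true => bicliq d r k (t.filter (d m)) (B.filter (r m))
      | false => false) A

/-- Disjointness of masks. -/
def disjM (p q : ℕ × ℕ) : Bool := Nat.beq (Nat.land p.1 q.1) 0

/-- Disjoint, touching masks. -/
def touchM (p q : ℕ × ℕ) : Bool := match Nat.beq (Nat.land p.1 q.1) 0 with
  | true => match Nat.beq (Nat.land p.2 q.1) 0 with
    | true => false
    | false => true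
  | false => false

/-- Search for a `K₃₃`: as `bicliq`, up to exchanging the two sides. -/
def bicliq33 {α : Type} (d r : α → α → Bool) (l : List α) : Bool :=
  anyTail (fun m t => match three (t.filter (r m)) with
      | true => bicliq d r 2 (t.filter (d m)) (t.filter (r m))
      | false => false) l

theorem search5 : cliq touchM 5 connTab = false := by decide +kernel

theorem search33 : bicliq33 disjM touchM connTab = false := by decide +kernel

/-! ### Soundness of the search -/

theorem anyTail_cons {α : Type} (p : α → List α → Bool) (a : α) (l : List α) :
    anyTail p (a :: l) = true ↔ p a l = true ∨ anyTail p l = true := by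
  rw [anyTail]
  cases p a l <;> simp

theorem cliq_spec {α : Type} [DecidableEq α] (r : α → α → Bool) :
    ∀ (k : ℕ) (l : List α) (S : Finset α), S.card = k → (∀ a ∈ S, a ∈ l) →
      (∀ a ∈ S, ∀ b ∈ S, a ≠ b → r a b = true) → cliq r k l = true
  | 0, _, _, _, _, _ => rfl
  | k + 1, [], S, hk, hl, _ => by
    have : S = ∅ := Finset.eq_empty_of_forall_notMem (fun a ha => by simpa using hl a ha)
    simp [this] at hk
  | k + 1, m :: l, S, hk, hl, hr => by
    rw [cliq, anyTail_cons]
    by_cases hm : m ∈ S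
    · left
      apply cliq_spec r k _ (S.erase m)
      · rw [Finset.card_erase_of_mem hm, hk]; rfl
      · intro a ha
        rw [Finset.mem_erase] at ha
        rw [List.mem_filter]
        exact ⟨(List.mem_cons.1 (hl a ha.2)).resolve_left ha.1, hr m hm a ha.2 ha.1.symm⟩
      · intro a ha b hb hab
        exact hr a (Finset.mem_of_mem_erase ha) b (Finset.mem_of_mem_erase hb) hab
    · right
      have := cliq_spec r (k + 1) l S hk (fun a ha => (List.mem_cons.1 (hl a ha)).resolve_left
        (fun h => hm (h ▸ ha))) hr
      rwa [cliq] at this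

theorem three_spec {α : Type} [DecidableEq α] (l : List α) (T : Finset α) (hT : T.card = 3)
    (hl : ∀ a ∈ T, a ∈ l) : three l = true := by
  have h1 : T ⊆ l.toFinset := fun a ha => by simpa using hl a ha
  have h2 := (Finset.card_le_card h1).trans (List.toFinset_card_le l)
  rw [hT] at h2
  match l, h2 with
  | _ :: _ :: _ :: _, _ => rfl
  | [], h => simp at h
  | [_], h => simp at h
  | [_, _], h => simp at h

theorem bicliq_spec {α : Type} [DecidableEq α] (d r : α → α → Bool) :
    ∀ (k : ℕ) (A B : List α) (S T : Finset α), S.card = k → T.card = 3 →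
      (∀ a ∈ S, a ∈ A) → (∀ a ∈ T, a ∈ B) →
      (∀ a ∈ S, ∀ b ∈ S, a ≠ b → d a b = true) →
      (∀ a ∈ T, ∀ b ∈ T, a ≠ b → d a b = true) →
      (∀ a ∈ S, ∀ b ∈ T, r a b = true) → bicliq d r k A B = true
  | 0, _, B, _, T, _, hT, _, hB, _, hTd, _ => cliq_spec d 3 B T hT hB hTd
  | k + 1, [], _, S, _, hk, _, hl, _, _, _, _ => by
    have : S = ∅ := Finset.eq_empty_of_forall_notMem (fun a ha => by simpa using hl a ha)
    simp [this] at hk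
  | k + 1, m :: A, B, S, T, hk, hT, hA, hB, hSd, hTd, hr => by
    rw [bicliq, anyTail_cons]
    by_cases hm : m ∈ S
    · left
      have hB' : ∀ a ∈ T, a ∈ B.filter (r m) := fun a ha =>
        List.mem_filter.2 ⟨hB a ha, hr m hm a ha⟩
      rw [three_spec _ T hT hB']
      apply bicliq_spec d r k _ _ (S.erase m) T
      · rw [Finset.card_erase_of_mem hm, hk]; rfl
      · exact hT
      · intro a ha
        rw [Finset.mem_erase] at ha
        rw [List.mem_filter]
        exact ⟨(List.mem_cons.1 (hA a ha.2)).resolve_left ha.1, hSd m hm a ha.2 ha.1.symm⟩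
      · exact hB'
      · intro a ha b hb hab
        exact hSd a (Finset.mem_of_mem_erase ha) b (Finset.mem_of_mem_erase hb) hab
      · exact hTd
      · intro a ha b hb
        exact hr a (Finset.mem_of_mem_erase ha) b hb
    · right
      have := bicliq_spec d r (k + 1) A B S T hk hT (fun a ha =>
        (List.mem_cons.1 (hA a ha)).resolve_left (fun h => hm (h ▸ ha))) hB hSd hTd hr
      rwa [bicliq] at this

theorem bicliq33_spec {α : Type} [DecidableEq α] (d r : α → α → Bool) :
    ∀ (l : List α) (S T : Finset α), S.card = 3 → T.card = 3 →
      (∀ a ∈ S, a ∈ l) → (∀ a ∈ T, a ∈ l) →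
      (∀ a ∈ S, ∀ b ∈ S, a ≠ b → d a b = true) →
      (∀ a ∈ T, ∀ b ∈ T, a ≠ b → d a b = true) →
      (∀ a ∈ S, ∀ b ∈ T, a ≠ b ∧ r a b = true ∧ r b a = true) → bicliq33 d r l = true
  | [], S, _, hk, _, hl, _, _, _, _ => by
    have : S = ∅ := Finset.eq_empty_of_forall_notMem (fun a ha => by simpa using hl a ha)
    simp [this] at hk
  | m :: l, S, T, hS, hT, hSl, hTl, hSd, hTd, hr => by
    rw [bicliq33, anyTail_cons]
    -- the case where the first element belongs to a given side
    have main : ∀ S T : Finset α, S.card = 3 → T.card = 3 →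
        (∀ a ∈ S, a ∈ m :: l) → (∀ a ∈ T, a ∈ m :: l) →
        (∀ a ∈ S, ∀ b ∈ S, a ≠ b → d a b = true) →
        (∀ a ∈ T, ∀ b ∈ T, a ≠ b → d a b = true) →
        (∀ a ∈ S, ∀ b ∈ T, a ≠ b ∧ r a b = true) → m ∈ S →
        (match three (l.filter (r m)) with
          | true => bicliq d r 2 (l.filter (d m)) (l.filter (r m))
          | false => false) = true := by
      intro S T hS hT hSl hTl hSd hTd hr hm
      have hB' : ∀ a ∈ T, a ∈ l.filter (r m) := fun a ha =>
        List.mem_filter.2 ⟨(List.mem_cons.1 (hTl a ha)).resolve_left (hr m hm a ha).1.symm,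
          (hr m hm a ha).2⟩
      rw [three_spec _ T hT hB']
      apply bicliq_spec d r 2 _ _ (S.erase m) T
      · rw [Finset.card_erase_of_mem hm, hS]
      · exact hT
      · intro a ha
        rw [Finset.mem_erase] at ha
        rw [List.mem_filter]
        exact ⟨(List.mem_cons.1 (hSl a ha.2)).resolve_left ha.1, hSd m hm a ha.2 ha.1.symm⟩
      · exact hB'
      · intro a ha b hb hab
        exact hSd a (Finset.mem_of_mem_erase ha) b (Finset.mem_of_mem_erase hb) hab
      · exact hTd
      · intro a ha b hb
        exact (hr a (Finset.mem_of_mem_erase ha) b hb).2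
    by_cases hm : m ∈ S
    · left
      exact main S T hS hT hSl hTl hSd hTd (fun a ha b hb => ⟨(hr a ha b hb).1, (hr a ha b hb).2.1⟩)
        hm
    · by_cases hm' : m ∈ T
      · left
        exact main T S hT hS hTl hSl hTd hSd
          (fun a ha b hb => ⟨(hr b hb a ha).1.symm, (hr b hb a ha).2.2⟩) hm'
      · right
        have := bicliq33_spec d r l S T hS hT
          (fun a ha => (List.mem_cons.1 (hSl a ha)).resolve_left (fun h => hm (h ▸ ha)))
          (fun a ha => (List.mem_cons.1 (hTl a ha)).resolve_left (fun h => hm' (h ▸ ha)))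
          hSd hTd hr
        rwa [bicliq33] at this

/-! ### The example graph -/

/-- Adjacency of the example graph on natural numbers. -/
def exAdj (x y : ℕ) : Bool := Nat.testBit (exRows.getD x 0) y

/-- The example graph: two octahedra glued along a triangle, a vertex (5) joined to all
of this, and a vertex (3) joined to the triangle. -/
def exG : SimpleGraph (Fin 11) where
  Adj x y := exAdj x y = true
  symm := ⟨by unfold exAdj; decide +kernel⟩
  loopless := ⟨by unfold exAdj; decide +kernel⟩

instance : DecidableRel exG.Adj := fun x y => inferInstanceAs (Decidable (exAdj x y = true))

/-- Union of the rows selected by the mask (avoiding 3 and 5). -/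
def nbMask (m : ℕ) : List ℕ → ℕ → ℕ
  | [], _ => 0
  | a :: l, i => Nat.lor (bif Nat.testBit m i then Nat.land a 2007 else 0) (nbMask m l (i + 1))

/-- Bit mask of a vertex set. -/
noncomputable def mask (s : Set (Fin 11)) : ℕ :=
  open Classical in Nat.ofBits (fun i : Fin 11 => decide (i ∈ s))

theorem mask_testBit (s : Set (Fin 11)) (i : Fin 11) :
    Nat.testBit (mask s) i = true ↔ i ∈ s := by
  unfold mask
  rw [Nat.testBit_ofBits_lt _ _ i.2]
  simp

theorem mask_lt (s : Set (Fin 11)) : mask s < 2048 := Nat.ofBits_lt_two_pow _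

theorem natBeq_iff (a b : ℕ) : Nat.beq a b = true ↔ a = b :=
  ⟨Nat.eq_of_beq_eq_true, fun h => h ▸ Nat.beq_refl a⟩

theorem nbMask_spec (m y : ℕ) (hy : Nat.testBit 2007 y = true) :
    ∀ (l : List ℕ) (i k : ℕ), Nat.testBit m (i + k) = true →
      Nat.testBit (l.getD k 0) y = true → Nat.testBit (nbMask m l i) y = true
  | [], _, _, _, h => by simp at h
  | a :: l, i, 0, hm, h => by
    rw [nbMask]
    change Nat.testBit (_ ||| _) y = true
    rw [Nat.testBit_or]
    have h' : Nat.testBit a y = true := by simpa using h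
    have hm' : Nat.testBit m i = true := by simpa using hm
    rw [hm', cond_true]
    change (Nat.testBit (a &&& 2007) y || _) = true
    rw [Nat.testBit_and, h', hy]
    rfl
  | a :: l, i, k + 1, hm, h => by
    rw [nbMask]
    change Nat.testBit (_ ||| _) y = true
    rw [Nat.testBit_or]
    have := nbMask_spec m y hy l (i + 1) k (by rw [← hm]; congr 1; omega) (by simpa using h)
    rw [this, Bool.or_true]

/-- Check that `connTab` lists all connected sets avoiding 3 and 5. -/
def connCheck (m : ℕ) : Bool :=
  !(Nat.beq (Nat.land m 40) 0) || Nat.beq m 0 ||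
  connTab.any (fun p => Nat.beq p.1 m && Nat.beq p.2 (nbMask m exRows 0)) ||
  sepTab.any (fun p => Nat.beq p.1 m && !(Nat.beq p.2 0) && !(Nat.beq p.2 m) &&
    Nat.beq (Nat.land p.2 m) p.2 &&
    Nat.beq (Nat.lor (Nat.land (nbMask p.2 exRows 0) m) p.2) p.2)

theorem connCheck_all : (List.range 2048).all connCheck = true := by decide +kernel

theorem ok_bits : ∀ i : Fin 11, i ≠ 3 → i ≠ 5 → Nat.testBit 2007 i = true := by decide

theorem conn_mem (s : Set (Fin 11)) (hs : CutConn exG s) (h3 : (3 : Fin 11) ∉ s)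
    (h5 : (5 : Fin 11) ∉ s) : (mask s, nbMask (mask s) exRows 0) ∈ connTab := by
  have hc := List.all_eq_true.1 connCheck_all (mask s) (List.mem_range.2 (mask_lt s))
  simp only [connCheck, Bool.or_eq_true, Bool.not_eq_true', List.any_eq_true,
    Bool.and_eq_true, natBeq_iff, ← Bool.not_eq_true] at hc
  have hbit : ∀ i : ℕ, Nat.testBit (mask s) i = true → ∃ h : i < 11, (⟨i, h⟩ : Fin 11) ∈ s := by
    intro i hi
    have hlt : i < 11 := by
      by_contra hcon
      rw [Nat.testBit_lt_two_pow (lt_of_lt_of_le (mask_lt s)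
        (Nat.pow_le_pow_right (n := 2) (by norm_num) (not_lt.1 hcon)))] at hi
      exact absurd hi (by simp)
    exact ⟨hlt, (mask_testBit s ⟨i, hlt⟩).1 hi⟩
  rcases hc with ((hc | hc) | ⟨p, hp, h1, h2⟩) | ⟨p, hp, h1⟩
  · exfalso
    apply hc
    change mask s &&& 40 = 0
    apply Nat.eq_of_testBit_eq
    intro i
    rw [Nat.testBit_and, Nat.zero_testBit]
    by_contra hcon
    rw [Bool.not_eq_false, Bool.and_eq_true] at hcon
    obtain ⟨hi, his⟩ := hbit i hcon.1
    have h40 : ∀ j : Fin 11, Nat.testBit 40 j = true → j = 3 ∨ j = 5 := by decide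
    rcases h40 ⟨i, hi⟩ hcon.2 with h | h
    · exact h3 (h ▸ his)
    · exact h5 (h ▸ his)
  · exfalso
    obtain ⟨x, hx⟩ := hs.1
    have := (mask_testBit s x).2 hx
    rw [hc, Nat.zero_testBit] at this
    exact absurd this (by simp)
  · rw [← h1] at h2 ⊢
    rw [← h2]
    exact hp
  · exfalso
    obtain ⟨⟨⟨⟨hm, hc0⟩, hcm⟩, hsub⟩, hcl⟩ := h1
    set c := p.2
    change c &&& mask s = c at hsub
    change (nbMask c exRows 0 &&& mask s) ||| c = c at hcl
    have hcs : ∀ i : ℕ, Nat.testBit c i = true → Nat.testBit (mask s) i = true := by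
      intro i hi
      rw [← hsub, Nat.testBit_and, Bool.and_eq_true] at hi
      exact hi.2
    have := hs.2 {v | Nat.testBit c v = true}
      (fun v hv => (mask_testBit s v).1 (hcs v hv)) (by
        obtain ⟨i, hi⟩ := Nat.exists_testBit_of_ne_zero hc0
        obtain ⟨hi', _⟩ := hbit i (hcs i hi)
        exact ⟨⟨i, hi'⟩, hi⟩) (by
        intro x hx y hy hxy
        have hy' : Nat.testBit 2007 y = true :=
          ok_bits y (fun h => h3 (h ▸ hy)) (fun h => h5 (h ▸ hy))
        have hn := nbMask_spec c y hy' exRows 0 x (by simpa using hx) hxy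
        change Nat.testBit c y = true
        rw [← hcl, Nat.testBit_or, Nat.testBit_and, hn, (mask_testBit s y).2 hy]
        rfl)
    apply hcm
    apply Nat.eq_of_testBit_eq
    intro i
    rw [Bool.eq_iff_iff]
    refine ⟨hcs i, fun hi => ?_⟩
    obtain ⟨hi', his⟩ := hbit i hi
    rw [← this] at his
    exact his

/-- Mask data of a branch set. -/
noncomputable def mk2 (s : Set (Fin 11)) : ℕ × ℕ := (mask s, nbMask (mask s) exRows 0)

theorem disj_mask (s t : Set (Fin 11)) (h : ∀ x, x ∈ s → x ∉ t) :
    Nat.land (mask s) (mask t) = 0 := by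
  change mask s &&& mask t = 0
  apply Nat.eq_of_testBit_eq
  intro i
  rw [Nat.testBit_and, Nat.zero_testBit]
  by_contra hcon
  rw [Bool.not_eq_false, Bool.and_eq_true] at hcon
  by_cases hi : i < 11
  · exact h ⟨i, hi⟩ ((mask_testBit s ⟨i, hi⟩).1 hcon.1) ((mask_testBit t ⟨i, hi⟩).1 hcon.2)
  · have hi' := hcon.1
    rw [Nat.testBit_lt_two_pow (lt_of_lt_of_le (mask_lt s)
        (Nat.pow_le_pow_right (n := 2) (by norm_num) (not_lt.1 hi)))] at hi'
    exact absurd hi' (by simp)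

theorem mk2_disj (s t : Set (Fin 11)) (h : ∀ x, x ∈ s → x ∉ t) :
    disjM (mk2 s) (mk2 t) = true := by
  simp only [disjM, mk2, disj_mask s t h]
  rfl

theorem mk2_touch (s t : Set (Fin 11)) (h : ∀ x, x ∈ s → x ∉ t)
    (h3 : (3 : Fin 11) ∉ t) (h5 : (5 : Fin 11) ∉ t)
    (ha : ∃ x ∈ s, ∃ y ∈ t, exG.Adj x y) : touchM (mk2 s) (mk2 t) = true := by
  simp only [touchM, mk2, disj_mask s t h]
  obtain ⟨x, hx, y, hy, hxy⟩ := ha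
  have hy' : Nat.testBit 2007 y = true :=
    ok_bits y (fun h => h3 (h ▸ hy)) (fun h => h5 (h ▸ hy))
  have hn := nbMask_spec (mask s) y hy' exRows 0 x
    (by simpa using (mask_testBit s x).2 hx) hxy
  have hne : Nat.beq (Nat.land (nbMask (mask s) exRows 0) (mask t)) 0 = false := by
    rw [← Bool.not_eq_true, natBeq_iff]
    change ¬ (nbMask (mask s) exRows 0 &&& mask t) = 0
    intro h0
    have := Nat.testBit_and (nbMask (mask s) exRows 0) (mask t) y
    rw [h0, hn, (mask_testBit t y).2 hy, Nat.zero_testBit] at this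
    exact absurd this (by simp)
  rw [hne]

theorem mk2_ne (s t : Set (Fin 11)) (hs : s.Nonempty) (h : ∀ x, x ∈ s → x ∉ t) :
    mk2 s ≠ mk2 t := by
  intro he
  have he' : mask s = mask t := congrArg Prod.fst he
  obtain ⟨x, hx⟩ := hs
  have := (mask_testBit s x).2 hx
  rw [he', mask_testBit] at this
  exact h x hx this

/-- There is no `K₅` model avoiding 3 and 5. -/
theorem no_K5 (f : Fin 5 → Set (Fin 11)) (hf : IsModel (⊤ : SimpleGraph (Fin 5)) exG f)
    (h3 : ∀ t, (3 : Fin 11) ∉ f t) (h5 : ∀ t, (5 : Fin 11) ∉ f t) : False := by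
  have hinj : Function.Injective (fun t => mk2 (f t)) := by
    intro a b hab
    by_contra hne
    exact mk2_ne _ _ (hf.conn a).1 (hf.disj a b hne) hab
  have := cliq_spec touchM 5 connTab (Finset.univ.image (fun t => mk2 (f t)))
    (by rw [Finset.card_image_of_injective _ hinj]; simp)
    (by
      intro a ha
      obtain ⟨t, -, rfl⟩ := Finset.mem_image.1 ha
      exact conn_mem _ (hf.conn t) (h3 t) (h5 t))
    (by
      intro a ha b hb hab
      obtain ⟨s, -, rfl⟩ := Finset.mem_image.1 ha
      obtain ⟨t, -, rfl⟩ := Finset.mem_image.1 hb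
      have hst : s ≠ t := fun h => hab (by rw [h])
      exact mk2_touch _ _ (hf.disj s t hst) (h3 t) (h5 t) (hf.edge s t hst))
  rw [search5] at this
  exact absurd this (by simp)

/-- `K₃₃`, with sides `{0, 1, 2}` and `{3, 4, 5}`. -/
def K33 : SimpleGraph (Fin 6) where
  Adj x y := (decide (x.val < 3) != decide (y.val < 3)) = true
  symm := ⟨by decide⟩
  loopless := ⟨by decide⟩

/-- There is no `K₃₃` model avoiding 3 and 5. -/
theorem no_K33 (f : Fin 6 → Set (Fin 11)) (hf : IsModel K33 exG f)
    (h3 : ∀ t, (3 : Fin 11) ∉ f t) (h5 : ∀ t, (5 : Fin 11) ∉ f t) : False := by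
  have hinj : Function.Injective (fun t => mk2 (f t)) := by
    intro a b hab
    by_contra hne
    exact mk2_ne _ _ (hf.conn a).1 (hf.disj a b hne) hab
  have hmem : ∀ t, mk2 (f t) ∈ connTab := fun t => conn_mem _ (hf.conn t) (h3 t) (h5 t)
  have hd : ∀ U : Finset (Fin 6), ∀ a ∈ U.image (fun t => mk2 (f t)),
      ∀ b ∈ U.image (fun t => mk2 (f t)), a ≠ b → disjM a b = true := by
    intro U a ha b hb hab
    obtain ⟨s, -, rfl⟩ := Finset.mem_image.1 ha
    obtain ⟨t, -, rfl⟩ := Finset.mem_image.1 hb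
    have hst : s ≠ t := fun h => hab (by rw [h])
    exact mk2_disj _ _ (hf.disj s t hst)
  have := bicliq33_spec disjM touchM connTab (({0, 1, 2} : Finset (Fin 6)).image (fun t => mk2 (f t)))
    (({3, 4, 5} : Finset (Fin 6)).image (fun t => mk2 (f t)))
    (by rw [Finset.card_image_of_injective _ hinj]; rfl)
    (by rw [Finset.card_image_of_injective _ hinj]; rfl)
    (by
      intro a ha
      obtain ⟨t, -, rfl⟩ := Finset.mem_image.1 ha
      exact hmem t)
    (by
      intro a ha
      obtain ⟨t, -, rfl⟩ := Finset.mem_image.1 ha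
      exact hmem t)
    (hd _) (hd _)
    (by
      intro a ha b hb
      obtain ⟨s, hs, rfl⟩ := Finset.mem_image.1 ha
      obtain ⟨t, ht, rfl⟩ := Finset.mem_image.1 hb
      have hkey : ∀ s ∈ ({0, 1, 2} : Finset (Fin 6)), ∀ t ∈ ({3, 4, 5} : Finset (Fin 6)),
          s ≠ t ∧ (decide (s.val < 3) != decide (t.val < 3)) = true := by decide
      obtain ⟨hst, hadj⟩ := hkey s hs t ht
      have hadj' : K33.Adj s t := hadj
      exact ⟨fun h => hst (hinj h),
        mk2_touch _ _ (hf.disj s t hst) (h3 t) (h5 t) (hf.edge s t hadj'),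
        mk2_touch _ _ (hf.disj t s hst.symm) (h3 s) (h5 s) (hf.edge t s hadj'.symm)⟩)
  rw [search33] at this
  exact absurd this (by simp)

/-! ### The Petersen family -/

/-- Adjacency of the seven graphs on natural numbers. -/
def famAdj (i x y : ℕ) : Bool := Nat.testBit ((famRows i).getD x 0) y

theorem famAdj_symm : ∀ i : Fin 7, ∀ x y : Fin (famN i),
    famAdj i x y = true → famAdj i y x = true := by decide +kernel

theorem famAdj_irrefl : ∀ i : Fin 7, ∀ x : Fin (famN i), ¬ famAdj i x x = true := by
  decide +kernel

/-- The seven graphs of the Petersen family. -/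
def famG (i : Fin 7) : SimpleGraph (Fin (famN i)) where
  Adj x y := famAdj i x y = true
  symm := ⟨famAdj_symm i⟩
  loopless := ⟨famAdj_irrefl i⟩

instance (i : Fin 7) : DecidableRel (famG i).Adj :=
  fun x y => inferInstanceAs (Decidable (famAdj i x y = true))

/-- Validity of a table entry. -/
def entOk (i j : ℕ) (l : List ℕ) : Bool :=
  decide (famN j = famN i + 1) &&
  ((List.range (famN i + 1)).all fun a => decide (l.getD a 0 < famN j) &&
    (List.range (famN i + 1)).all fun b => decide (a = b) || !decide (l.getD a 0 = l.getD b 0)) &&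
  ((List.range (famN i)).all fun s => (List.range (famN i)).all fun t =>
    (famAdj i s t == (famAdj j (l.getD (s + 1) 0) (l.getD (t + 1) 0) ||
      (!decide (s = t) && famAdj j (l.getD 0 0) (l.getD (s + 1) 0) &&
        famAdj j (l.getD 0 0) (l.getD (t + 1) 0)))) &&
    !(famAdj j (l.getD 0 0) (l.getD (s + 1) 0) && famAdj j (l.getD 0 0) (l.getD (t + 1) 0) &&
      famAdj j (l.getD (s + 1) 0) (l.getD (t + 1) 0)))

theorem entOk_all : ∀ i j : Fin 7, ∀ l ∈ famTab i j, entOk i j l = true := by decide +kernel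

theorem tab_delta : ∀ i : Fin 7, ∀ a b c : Fin (famN i), famAdj i a b = true →
    famAdj i b c = true → famAdj i a c = true → ∃ j : Fin 7, ∃ l ∈ famTab i j,
      ∀ s : Fin (famN i), famAdj j (l.getD 0 0) (l.getD (s + 1) 0) = true ↔
        s = a ∨ s = b ∨ s = c := by decide +kernel

theorem tab_y : ∀ j : Fin 7, ∀ z : Fin (famN j),
    3 < (Finset.univ.filter (fun t => (famG j).Adj z t)).card ∨
      ∃ i : Fin 7, ∃ l ∈ famTab i j, l.getD 0 0 = z := by decide +kernel

/-- Graph `j` is the result of a `∇Y`-move on graph `i`, through the bijection `σ`. -/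
structure Ent (i j : Fin 7) (σ : Option (Fin (famN i)) ≃ Fin (famN j)) : Prop where
  adj : ∀ s t, (famG i).Adj s t ↔ (famG j).Adj (σ (some s)) (σ (some t)) ∨
    (s ≠ t ∧ (famG j).Adj (σ none) (σ (some s)) ∧ (famG j).Adj (σ none) (σ (some t)))
  ind : ∀ s t, (famG j).Adj (σ none) (σ (some s)) → (famG j).Adj (σ none) (σ (some t)) →
    ¬ (famG j).Adj (σ (some s)) (σ (some t))

/-- Position of a vertex in a table entry. -/
def optIdx {n : ℕ} : Option (Fin n) → ℕ
  | none => 0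
  | some s => s + 1

theorem optIdx_lt {n : ℕ} (o : Option (Fin n)) : optIdx o < n + 1 := by
  cases o with
  | none => exact Nat.succ_pos _
  | some s => exact Nat.succ_lt_succ s.2

theorem optIdx_inj {n : ℕ} : Function.Injective (optIdx (n := n)) := by
  rintro (_ | a) (_ | b) h
  · rfl
  · simp [optIdx] at h
  · simp [optIdx] at h
  · simp only [optIdx, Nat.add_right_cancel_iff] at h
    rw [Fin.ext h]

theorem entOk_spec (i j : Fin 7) (l : List ℕ) (h : entOk i j l = true) :
    ∃ σ : Option (Fin (famN i)) ≃ Fin (famN j), Ent i j σ ∧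
      ∀ o, (σ o : ℕ) = l.getD (optIdx o) 0 := by
  simp only [entOk, Bool.and_eq_true, decide_eq_true_eq, List.all_eq_true, List.mem_range,
    Bool.or_eq_true, Bool.not_eq_true', decide_eq_false_iff_not, beq_iff_eq] at h
  obtain ⟨⟨hn, hinj⟩, hadj⟩ := h
  let g : Option (Fin (famN i)) → Fin (famN j) :=
    fun o => ⟨l.getD (optIdx o) 0, (hinj _ (optIdx_lt o)).1⟩
  have hg : Function.Injective g := by
    intro a b hab
    have hab' : l.getD (optIdx a) 0 = l.getD (optIdx b) 0 := congrArg Fin.val hab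
    rcases (hinj _ (optIdx_lt a)).2 _ (optIdx_lt b) with h | h
    · exact optIdx_inj h
    · exact absurd hab' h
  have hbij : Function.Bijective g := by
    rw [Fintype.bijective_iff_injective_and_card]
    refine ⟨hg, ?_⟩
    simp [hn]
  refine ⟨Equiv.ofBijective g hbij, ⟨?_, ?_⟩, fun o => rfl⟩
  · intro s t
    obtain ⟨h1, -⟩ := hadj s s.2 t t.2
    change famAdj i s t = true ↔ famAdj j (l.getD (s + 1) 0) (l.getD (t + 1) 0) = true ∨
      (s ≠ t ∧ famAdj j (l.getD 0 0) (l.getD (s + 1) 0) = true ∧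
        famAdj j (l.getD 0 0) (l.getD (t + 1) 0) = true)
    rw [h1]
    simp only [Bool.or_eq_true, Bool.and_eq_true, Bool.not_eq_true', decide_eq_false_iff_not,
      and_assoc, ne_eq, Fin.ext_iff]
  · intro s t h1 h2 h3
    obtain ⟨-, h4⟩ := hadj s s.2 t t.2
    change famAdj j (l.getD 0 0) (l.getD (s + 1) 0) = true at h1
    change famAdj j (l.getD 0 0) (l.getD (t + 1) 0) = true at h2
    change famAdj j (l.getD (s + 1) 0) (l.getD (t + 1) 0) = true at h3
    rw [h1, h2, h3] at h4
    exact absurd h4 (by simp)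

theorem ent_delta (i : Fin 7) (a b c : Fin (famN i)) (hab : (famG i).Adj a b)
    (hbc : (famG i).Adj b c) (hac : (famG i).Adj a c) :
    ∃ (j : Fin 7) (σ : Option (Fin (famN i)) ≃ Fin (famN j)), Ent i j σ ∧
      ∀ s, (famG j).Adj (σ none) (σ (some s)) ↔ s = a ∨ s = b ∨ s = c := by
  obtain ⟨j, l, hl, hs⟩ := tab_delta i a b c hab hbc hac
  obtain ⟨σ, h1, h2⟩ := entOk_spec i j l (entOk_all i j l hl)
  refine ⟨j, σ, h1, fun s => ?_⟩
  rw [← hs s]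
  change famAdj j (σ none) (σ (some s)) = true ↔ _
  rw [h2, h2]
  rfl

theorem ent_y (j : Fin 7) (z : Fin (famN j))
    (hz : (Finset.univ.filter (fun t => (famG j).Adj z t)).card ≤ 3) :
    ∃ (i : Fin 7) (σ : Option (Fin (famN i)) ≃ Fin (famN j)), Ent i j σ ∧ σ none = z := by
  obtain ⟨i, l, hl, hs⟩ := (tab_y j z).resolve_left (not_lt.2 hz)
  obtain ⟨σ, h1, h2⟩ := entOk_spec i j l (entOk_all i j l hl)
  refine ⟨i, σ, h1, Fin.ext ?_⟩
  rw [h2, ← hs]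
  rfl

theorem triY_none {V : Type} (G : SimpleGraph V) (a b c x : V) :
    (triangleY G a b c).Adj none (some x) ↔ x = a ∨ x = b ∨ x = c := by
  unfold triangleY
  rw [SimpleGraph.sup_adj, SimpleGraph.map_adj, SimpleGraph.fromEdgeSet_adj]
  simp

theorem triY_some {V : Type} (G : SimpleGraph V) (a b c x y : V) :
    (triangleY G a b c).Adj (some x) (some y) ↔ G.Adj x y ∧
      ¬ ((x = a ∨ x = b ∨ x = c) ∧ (y = a ∨ y = b ∨ y = c)) := by
  have h1 : (triangleY G a b c).Adj (some x) (some y) ↔ G.Adj x y ∧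
      s(x, y) ∉ ({s(a, b), s(b, c), s(a, c)} : Set (Sym2 V)) := by
    unfold triangleY
    rw [SimpleGraph.sup_adj, SimpleGraph.map_adj, SimpleGraph.fromEdgeSet_adj]
    simp [SimpleGraph.deleteEdges_adj]
  rw [h1]
  apply and_congr_right
  intro hxy
  have hne := hxy.ne
  simp only [Set.mem_insert_iff, Set.mem_singleton_iff, Sym2.eq_iff]
  grind

/-- Being isomorphic to one of the seven graphs. -/
def InFam {V : Type} (H : SimpleGraph V) : Prop := ∃ i : Fin 7, Nonempty (H ≃g famG i)

theorem inFam_delta {V : Type} {G : SimpleGraph V} {a b c : V} (h : InFam G)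
    (hab : G.Adj a b) (hbc : G.Adj b c) (hac : G.Adj a c) : InFam (triangleY G a b c) := by
  obtain ⟨i, ⟨e⟩⟩ := h
  obtain ⟨j, σ, hE, hs⟩ := ent_delta i (e a) (e b) (e c) (e.map_rel_iff.2 hab)
    (e.map_rel_iff.2 hbc) (e.map_rel_iff.2 hac)
  have hs' : ∀ x, (famG j).Adj (σ none) (σ (some (e x))) ↔ x = a ∨ x = b ∨ x = c := by
    intro x
    rw [hs]
    simp only [EmbeddingLike.apply_eq_iff_eq]
  refine ⟨j, ⟨(Equiv.optionCongr e.toEquiv).trans σ, ?_⟩⟩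
  rintro (_ | x) (_ | y)
  · simp
  · rw [triY_none]
    exact hs' y
  · rw [SimpleGraph.adj_comm, SimpleGraph.adj_comm (triangleY G a b c), triY_none]
    exact hs' x
  · rw [triY_some]
    have h1 := hE.adj (e x) (e y)
    rw [hs', hs'] at h1
    have h2 := hE.ind (e x) (e y)
    rw [hs', hs'] at h2
    have h3 : (famG i).Adj (e x) (e y) ↔ G.Adj x y := e.map_rel_iff
    rw [h3] at h1
    change (famG j).Adj (σ (some (e x))) (σ (some (e y))) ↔ _
    tauto

theorem inFam_y {V : Type} {G : SimpleGraph V} {a b c : V} (h : InFam (triangleY G a b c))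
    (hab : G.Adj a b) (hbc : G.Adj b c) (hac : G.Adj a c) : InFam G := by
  obtain ⟨j, ⟨e⟩⟩ := h
  have hdeg : (Finset.univ.filter (fun t => (famG j).Adj (e none) t)).card ≤ 3 := by
    refine le_trans (Finset.card_le_card (t := {e (some a), e (some b), e (some c)}) ?_)
      Finset.card_le_three
    intro t ht
    simp only [Finset.mem_filter, Finset.mem_univ, true_and] at ht
    obtain ⟨o, rfl⟩ := e.surjective t
    rw [e.map_rel_iff] at ht
    cases o with
    | none => simp at ht
    | some x =>
      rw [triY_none] at ht
      rcases ht with rfl | rfl | rfl <;> simp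
  obtain ⟨i, σ, hE, hz⟩ := ent_y j (e none) hdeg
  let τ : Option V ≃ Option (Fin (famN i)) := e.toEquiv.trans σ.symm
  have hτ0 : τ none = none := by
    change σ.symm (e none) = none
    rw [← hz, Equiv.symm_apply_apply]
  have hτ : ∀ x, some (Equiv.removeNone τ x) = τ (some x) := by
    intro x
    apply Equiv.removeNone_some
    rw [← Option.ne_none_iff_exists']
    intro hx
    have := τ.injective (hx.trans hτ0.symm)
    exact absurd this (by simp)
  have hσ : ∀ x, σ (some (Equiv.removeNone τ x)) = e (some x) := by
    intro x
    rw [hτ]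
    exact Equiv.apply_symm_apply _ _
  refine ⟨i, ⟨Equiv.removeNone τ, ?_⟩⟩
  intro x y
  rw [hE.adj, hσ, hσ, hz, e.map_rel_iff, e.map_rel_iff, e.map_rel_iff, triY_none, triY_none,
    triY_some, (Equiv.removeNone τ).injective.ne_iff]
  have hsymm := fun p q => G.adj_comm p q
  constructor
  · rintro (h | ⟨hne, hx, hy⟩)
    · exact h.1
    · rcases hx with rfl | rfl | rfl <;> rcases hy with rfl | rfl | rfl <;>
        first
        | exact absurd rfl hne
        | assumption
        | (apply SimpleGraph.Adj.symm; assumption)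
  · intro hxy
    have := hxy.ne
    tauto

theorem inFam_k6 : InFam (⊤ : SimpleGraph (Fin 6)) := by
  refine ⟨0, ⟨Equiv.refl (Fin 6), ?_⟩⟩
  intro x y
  change famAdj 0 x y = true ↔ x ≠ y
  revert x y
  decide +kernel

theorem inFam_of_petersen {V : Type} {H : SimpleGraph V} (h : IsPetersenFamily H) : InFam H := by
  induction h with
  | k6 => exact inFam_k6
  | deltaY _ hab hbc hac ih => exact inFam_delta ih hab hbc hac
  | yDelta _ hab hbc hac ih => exact inFam_y ih hab hbc hac
  | iso _ e ih =>
    obtain ⟨i, ⟨efam⟩⟩ := ih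
    exact ⟨i, ⟨e.symm.trans efam⟩⟩

/-! ### The example graph has no model of the Petersen family -/

/-- Adjacency of `K₃₃` on natural numbers. -/
def k33Adj (x y : ℕ) : Bool := decide (x < 3) != decide (y < 3)

/-- Adjacency of complete graphs on natural numbers. -/
def topAdj (x y : ℕ) : Bool := !decide (x = y)

theorem kur_all : ∀ i : Fin 7, ∀ z : Fin (famN i),
    (∀ l ∈ (kurTab i).getD z [], (z : ℕ) ∉ l) ∧
    (modelCheck 5 topAdj (famN i) (famAdj i) ((kurTab i).getD z []) = true ∨
      modelCheck 6 k33Adj (famN i) (famAdj i) ((kurTab i).getD z []) = true) := by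
  decide +kernel

theorem top_hH {k : ℕ} : ∀ x y : Fin k, (⊤ : SimpleGraph (Fin k)).Adj x y →
    topAdj x y = true := by
  intro x y h
  have : (x : ℕ) ≠ y := fun h' => h (Fin.ext h')
  simp [topAdj, this]

theorem getD_avoid {L : List (List ℕ)} {z : ℕ} (h : ∀ l ∈ L, z ∉ l) (a : ℕ) :
    z ∉ L.getD a [] := by
  by_cases ha : a < L.length
  · rw [List.getD_eq_getElem _ _ ha]
    exact h _ (List.getElem_mem ha)
  · rw [List.getD_eq_default _ _ (not_lt.1 ha)]
    simp

/-- No model avoids the vertex 3. -/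
theorem no_avoid3 (i : Fin 7) (f : Fin (famN i) → Set (Fin 11)) (hf : IsModel (famG i) exG f)
    (h3 : ∀ t, (3 : Fin 11) ∉ f t) : False := by
  have hz : ∃ z : Fin (famN i), ∀ t, t ≠ z → (5 : Fin 11) ∉ f t := by
    by_cases h : ∃ z, (5 : Fin 11) ∈ f z
    · obtain ⟨z, hz⟩ := h
      exact ⟨z, fun t ht h5 => hf.disj t z ht _ h5 hz⟩
    · have hpos : ∀ i : Fin 7, 0 < famN i := by decide
      exact ⟨⟨0, hpos i⟩, fun t _ h5 => h ⟨t, h5⟩⟩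
  obtain ⟨z, hz⟩ := hz
  obtain ⟨hav, hk⟩ := kur_all i z
  have key : ∀ k : ℕ, ∀ a : Fin k, ∀ u : Fin 11,
      u ∈ {v | ∃ s ∈ {v : Fin (famN i) | (v : ℕ) ∈ ((kurTab i).getD z []).getD a []}, v ∈ f s} →
      u ≠ 3 ∧ u ≠ 5 := by
    rintro k a u ⟨s, hs, hu⟩
    refine ⟨fun h => h3 s (h ▸ hu), fun h => ?_⟩
    refine hz s ?_ (h ▸ hu)
    rintro rfl
    exact getD_avoid hav a hs
  rcases hk with hk | hk
  · have hm := (modelCheck_spec (H := (⊤ : SimpleGraph (Fin 5))) (G := famG i)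
      (fun _ _ h => h) top_hH hk).trans hf
    exact no_K5 _ hm (fun t h => (key 5 t 3 h).1 rfl) (fun t h => (key 5 t 5 h).2 rfl)
  · have hm := (modelCheck_spec (H := K33) (G := famG i) (rH := k33Adj)
      (fun _ _ h => h) (fun _ _ h => h) hk).trans hf
    exact no_K33 _ hm (fun t h => (key 6 t 3 h).1 rfl) (fun t h => (key 6 t 5 h).2 rfl)

theorem ex_nbr3 : ∀ v : Fin 11, exG.Adj 3 v → v ∈ ({0, 1, 2} : Finset (Fin 11)) := by
  decide +kernel

theorem ex_clique3 : ∀ p q : Fin 11, exG.Adj 3 p → exG.Adj 3 q → p ≠ q → exG.Adj p q := by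
  decide +kernel

theorem no_model (j : Fin 7) (f : Fin (famN j) → Set (Fin 11)) (hf : IsModel (famG j) exG f) :
    False := by
  rcases hf.avoid 3 ex_clique3 with ⟨z, hz⟩ | ⟨f', hf', h3⟩
  swap
  · exact no_avoid3 j f' hf' h3
  have hdeg := hf.degree hz {0, 1, 2} ex_nbr3
  obtain ⟨i, σ, hE, hσ⟩ := ent_y j z (hdeg.trans (by decide))
  have hne : ∀ s, σ (some s) ≠ z := by
    intro s h
    have := σ.injective (h.trans hσ.symm)
    exact absurd this (by simp)
  have hnb : ∀ s, (famG j).Adj (σ none) (σ (some s)) → ∃ y ∈ f (σ (some s)), exG.Adj 3 y := by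
    intro s h
    rw [hσ] at h
    obtain ⟨x, hx, y, hy, hxy⟩ := hf.edge _ _ h
    rw [hz, Set.mem_singleton_iff] at hx
    exact ⟨y, hy, hx ▸ hxy⟩
  refine no_avoid3 i (fun s => f (σ (some s))) ⟨fun s => hf.conn _, ?_, ?_⟩ ?_
  · intro a b hab
    apply hf.disj
    intro h
    exact hab (Option.some_injective _ (σ.injective h))
  · intro a b hab
    rcases (hE.adj a b).1 hab with h | ⟨hne', h1, h2⟩
    · exact hf.edge _ _ h
    · obtain ⟨x, hx, hx'⟩ := hnb a h1
      obtain ⟨y, hy, hy'⟩ := hnb b h2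
      refine ⟨x, hx, y, hy, ex_clique3 x y hx' hy' ?_⟩
      rintro rfl
      refine hf.disj _ _ ?_ x hx hy
      intro h
      exact hne' (Option.some_injective _ (σ.injective h))
  · intro t ht
    refine hf.disj _ _ (hne t) 3 ht ?_
    rw [hz]
    rfl

theorem exG_linkless : IsLinkless exG := by
  intro W P hP hm
  obtain ⟨f, hf⟩ := (isMinor_iff _ _).1 hm
  obtain ⟨i, ⟨e⟩⟩ := inFam_of_petersen hP
  exact no_model i _ (hf.iso e)

/-! ### Adding edges -/

theorem addEdge_adj {V : Type} (G : SimpleGraph V) (a b x y : V) :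
    (addEdge G a b).Adj x y ↔ G.Adj x y ∨ (((x = a ∧ y = b) ∨ (x = b ∧ y = a)) ∧ x ≠ y) := by
  unfold addEdge
  rw [SimpleGraph.sup_adj, SimpleGraph.fromEdgeSet_adj, Set.mem_singleton_iff, Sym2.eq_iff]

/-- Adjacency in the example graph with an added edge. -/
def addAdj (a b x y : ℕ) : Bool :=
  exAdj x y || (decide (x = a) && decide (y = b)) || (decide (x = b) && decide (y = a))

theorem addAdj_spec {a b : Fin 11} (hab : a ≠ b) (x y : Fin 11) (h : addAdj a b x y = true) :
    (addEdge exG a b).Adj x y := by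
  rw [addEdge_adj]
  simp only [addAdj, Bool.or_eq_true, Bool.and_eq_true, decide_eq_true_eq] at h
  rcases h with (h | ⟨h1, h2⟩) | ⟨h1, h2⟩
  · exact Or.inl h
  · obtain rfl := Fin.ext h1
    obtain rfl := Fin.ext h2
    exact Or.inr ⟨Or.inl ⟨rfl, rfl⟩, hab⟩
  · obtain rfl := Fin.ext h1
    obtain rfl := Fin.ext h2
    exact Or.inr ⟨Or.inr ⟨rfl, rfl⟩, hab.symm⟩

theorem k6_all : ∀ a b : Fin 11, a ≠ b → exAdj a b = true ∨ (a = 3 ∧ b = 5) ∨ (a = 5 ∧ b = 3) ∨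
    ∃ p ∈ k6Tab, modelCheck 6 topAdj 11 (addAdj a b) p.2.2 = true := by
  decide +kernel

theorem addEdge_comm {V : Type} (G : SimpleGraph V) (a b : V) : addEdge G a b = addEdge G b a := by
  unfold addEdge
  rw [Sym2.eq_swap]

/-- Position of the vertices of the `∇Y` of `K₆`. -/
def optLast : Option (Fin 6) → Fin 7
  | none => 6
  | some s => s.castSucc

/-- A model of graph 1 after adding the edge 35. -/
def p7Lists : List (List ℕ) := [[3], [4], [8], [1], [2], [5], [9, 6, 0]]

theorem p7_check : modelCheck 7 (famAdj 1) 11 (addAdj 3 5) p7Lists = true := by decide +kernel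

theorem p7_minor : IsMinor (triangleY (⊤ : SimpleGraph (Fin 6)) 0 1 2) (addEdge exG 3 5) := by
  have hm : IsModel (famG 1) (addEdge exG 3 5) _ :=
    modelCheck_spec (k := 7) (H := famG 1) (G := addEdge exG 3 5) (rH := famAdj 1)
      (r := addAdj 3 5) (fun x y h => addAdj_spec (a := 3) (b := 5) (by decide) x y h)
      (fun _ _ h => h) p7_check
  have hadj0 : ∀ x : Fin 6, (x = 0 ∨ x = 1 ∨ x = 2) →
      famAdj 1 (optLast none) (optLast (some x)) = true ∧
      famAdj 1 (optLast (some x)) (optLast none) = true := by decide +kernel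
  have hadj1 : ∀ x y : Fin 6, x ≠ y → ¬ ((x = 0 ∨ x = 1 ∨ x = 2) ∧ (y = 0 ∨ y = 1 ∨ y = 2)) →
      famAdj 1 (optLast (some x)) (optLast (some y)) = true := by decide +kernel
  have hinj : ∀ a b, optLast a = optLast b → a = b := by decide
  rw [isMinor_iff]
  refine ⟨_, ⟨fun o => hm.conn (optLast o), fun a b hab => hm.disj (optLast a) (optLast b)
    (fun h => hab (hinj _ _ h)), fun a b hab => hm.edge (optLast a) (optLast b) ?_⟩⟩
  rcases a with _ | x <;> rcases b with _ | y
  · exact absurd rfl hab.ne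
  · rw [triY_none] at hab
    exact (hadj0 y hab).1
  · rw [SimpleGraph.adj_comm, triY_none] at hab
    exact (hadj0 x hab).2
  · rw [triY_some] at hab
    exact hadj1 x y hab.1 hab.2

theorem not_linkless35 : ¬ IsLinkless (addEdge exG 3 5) := fun h =>
  h _ (IsPetersenFamily.deltaY IsPetersenFamily.k6 (by decide) (by decide) (by decide)) p7_minor

theorem exG_max (a b : Fin 11) (hab : a ≠ b) (hn : ¬ exG.Adj a b) :
    ¬ IsLinkless (addEdge exG a b) := by
  rcases k6_all a b hab with h | ⟨rfl, rfl⟩ | ⟨rfl, rfl⟩ | ⟨p, _, hp⟩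
  · exact absurd h hn
  · exact not_linkless35
  · rw [addEdge_comm]
    exact not_linkless35
  · intro h
    exact h _ IsPetersenFamily.k6 ((isMinor_iff _ _).2
      ⟨_, modelCheck_spec (addAdj_spec hab) top_hH hp⟩)

theorem no_k6 : ¬ IsMinor (⊤ : SimpleGraph (Fin 6)) (addEdge exG 3 5) := by
  intro hm
  obtain ⟨f, hf⟩ := (isMinor_iff _ _).1 hm
  have hnb : ∀ v : Fin 11, (addEdge exG 3 5).Adj 3 v → v ∈ ({0, 1, 2, 5} : Finset (Fin 11)) := by
    intro v
    rw [addEdge_adj]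
    revert v
    decide +kernel
  have hcl : ∀ p q : Fin 11, (addEdge exG 3 5).Adj 3 p → (addEdge exG 3 5).Adj 3 q → p ≠ q →
      (addEdge exG 3 5).Adj p q := by
    intro p q
    rw [addEdge_adj, addEdge_adj, addEdge_adj]
    revert p q
    decide +kernel
  rcases hf.avoid 3 hcl with ⟨w, hw⟩ | ⟨f', hf', h3⟩
  · have := hf.degree hw {0, 1, 2, 5} hnb
    have hd : ∀ w : Fin 6, (Finset.univ.filter
        (fun t => (⊤ : SimpleGraph (Fin 6)).Adj w t)).card = 5 := by decide
    rw [hd w] at this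
    exact absurd this (by decide)
  · obtain ⟨i, ⟨e⟩⟩ := inFam_k6
    have hadj : ∀ a b, ∀ x ∈ f' a, ∀ y ∈ f' b, (addEdge exG 3 5).Adj x y → exG.Adj x y := by
      intro a b x hx y hy h
      rw [addEdge_adj] at h
      rcases h with h | ⟨⟨rfl, -⟩ | ⟨-, rfl⟩, -⟩
      · exact h
      · exact absurd hx (h3 a)
      · exact absurd hy (h3 b)
    have hf2 : IsModel (⊤ : SimpleGraph (Fin 6)) exG f' := by
      refine ⟨fun w => ⟨(hf'.conn w).1, ?_⟩, hf'.disj, ?_⟩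
      · intro c hc hne hcl'
        exact (hf'.conn w).2 c hc hne
          (fun x hx y hy h => hcl' x hx y hy (hadj w w x (hc hx) y hy h))
      · intro a b hab
        obtain ⟨x, hx, y, hy, hxy⟩ := hf'.edge a b hab
        exact ⟨x, hx, y, hy, hadj a b x hx y hy hxy⟩
    exact no_model i _ (hf2.iso e)

/-- There is a graph on 11 vertices that is maxnil (no Petersen-family minor, and adding
any edge creates one) but not maximal without a `K₆` minor: some edge can be added
without creating a `K₆` minor. -/
theorem stmt_14 :
    ∃ G : SimpleGraph (Fin 11),
      IsLinkless G ∧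
      (∀ a b : Fin 11, a ≠ b → ¬ G.Adj a b → ¬ IsLinkless (addEdge G a b)) ∧
      ∃ v w : Fin 11, v ≠ w ∧ ¬ G.Adj v w ∧
        ¬ IsMinor (⊤ : SimpleGraph (Fin 6)) (addEdge G v w) := by
  refine ⟨exG, exG_linkless, exG_max, 3, 5, by decide, by decide +kernel, no_k6⟩
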